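/- arXiv:2405.14593 — 2 statements merged into one kernel-verified Lean document; each statement's English description precedes it below -/
import Mathlib

section
/- Set ŷ_min = √(−b₊(m)/c₊(m)) (≈ 0.116589071022807). Then G₊(m, ŷ_min; δ) = 0 for every δ. Moreover, for every δ ∈ (0, δ_max]: (1) for each ŷ ∈ (0, 1/2] there is a unique s₊(ŷ;δ) ∈ [0, 1/2] with G₊(s₊(ŷ;δ), ŷ; δ) = 0; it lies in (0, 3m/2), and furthermore s₊(ŷ;δ) ∈ (m, 3m/2) if ŷ ∈ (ŷ_min, 1/2] and s₊(ŷ;δ) ∈ (0, m) if ŷ ∈ (0, ŷ_min); (2) for each ŷ ∈ (0, 1/2] there is a unique s₋(ŷ;δ) ∈ [0, 1/2] with G₋(s₋(ŷ;δ), ŷ; δ) = 0, and it lies in (2m/5, m). -/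
noncomputable section
open Real Set

namespace Secular

def U00 : ℝ := 0.762646
def U10 : ℝ := 0.547442
def U20 : ℝ := 0.237353
def mC : ℝ := (-4 + Real.sqrt 21) / 5
def rhoC : ℝ := 1.762157978551987e-18
def muC : ℝ := 398600.44
def aM : ℝ := 384400
def aMin : ℝ := 6378.14
def aMax : ℝ := 30000
def Lmin : ℝ := Real.sqrt (muC * aMin)
def Lmax : ℝ := Real.sqrt (muC * aMax)
def deltaFun (L : ℝ) : ℝ := rhoC * L ^ 10 / (muC ^ 3 * aM ^ 3)
def deltaMax : ℝ := deltaFun Lmax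
def rho0 : ℝ := muC ^ 4 * 1.08e-3 * 6378.14 ^ 2
def rho1 : ℝ := rhoC * rho0
def alphaCube (L : ℝ) : ℝ := L ^ 6 / (muC ^ 3 * aM ^ 3)

def aA (σ : ℝ) : ℝ := 1 - 16 * σ - 20 * σ ^ 2
def bB (σ : ℝ) : ℝ := (2 * σ + 3) * Real.sqrt (3 - 4 * σ - 4 * σ ^ 2)
def cPl (σ : ℝ) : ℝ := U00 / 2 * aA σ + 5 * U10 / 3 * bB σ
def cMi (σ : ℝ) : ℝ := U00 / 2 * aA σ - 5 * U10 / 3 * bB σ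
def Ap (σ δ : ℝ) : ℝ := aA σ + δ * cPl σ
def Am (σ δ : ℝ) : ℝ := aA σ + δ * cMi σ


/-- `a(s) = 5s² + 8s − 1`. -/
def aE (s : ℝ) : ℝ := 5 * s ^ 2 + 8 * s - 1
def bEp (s : ℝ) : ℝ :=
  10 * U00 * s * (1 + s) + 20 * U10 * (3 + s) * s ^ 2 / (3 * Real.sqrt (3 - 2*s - s^2))
def bEm (s : ℝ) : ℝ :=
  10 * U00 * s * (1 + s) - 20 * U10 * (3 + s) * s ^ 2 / (3 * Real.sqrt (3 - 2*s - s^2))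
def cEp (s : ℝ) : ℝ :=
  8 * U00 * (3*s - 1) + 20 * U10 * (3 + s) * (8*s - 12) / (3 * Real.sqrt (3 - 2*s - s^2))
def cEm (s : ℝ) : ℝ :=
  8 * U00 * (3*s - 1) - 20 * U10 * (3 + s) * (8*s - 12) / (3 * Real.sqrt (3 - 2*s - s^2))
def Gp (s yh δ : ℝ) : ℝ := aE s + 2 * δ * (bEp s * yh ^ 3 + cEp s * yh ^ 5)
def Gm (s yh δ : ℝ) : ℝ := aE s + 2 * δ * (bEm s * yh ^ 3 + cEm s * yh ^ 5)

/-- `ŷ_min = √(−b₊(m)/c₊(m))`. -/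
def yHatMin : ℝ := Real.sqrt (-(bEp mC) / cEp mC)

/-- The factor `(3 + s) / √(3 - 2s - s²)` shared by the coefficients. -/
def radicalFactor (s : ℝ) : ℝ := (3 + s) / Real.sqrt (3 - 2 * s - s ^ 2)

lemma bEp_eq (s : ℝ) :
    bEp s = 10 * U00 * s * (1 + s) + 20 / 3 * U10 * (radicalFactor s * s ^ 2) := by
  unfold bEp radicalFactor; ring

lemma bEm_eq (s : ℝ) :
    bEm s = 10 * U00 * s * (1 + s) - 20 / 3 * U10 * (radicalFactor s * s ^ 2) := by
  unfold bEm radicalFactor; ring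

lemma cEp_eq (s : ℝ) :
    cEp s = 8 * U00 * (3 * s - 1) - 20 / 3 * U10 * (radicalFactor s * (12 - 8 * s)) := by
  unfold cEp radicalFactor; ring

lemma cEm_eq (s : ℝ) :
    cEm s = 8 * U00 * (3 * s - 1) + 20 / 3 * U10 * (radicalFactor s * (12 - 8 * s)) := by
  unfold cEm radicalFactor; ring

lemma radicand_pos {s : ℝ} (hs : s ∈ Icc (0 : ℝ) (1 / 2)) : 0 < 3 - 2 * s - s ^ 2 := by
  nlinarith [hs.1, hs.2]

lemma radicalFactor_pos {s : ℝ} (hs : s ∈ Icc (0 : ℝ) (1 / 2)) : 0 < radicalFactor s :=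
  div_pos (by linarith [hs.1]) (Real.sqrt_pos.2 (radicand_pos hs))

lemma radicalFactor_sq {s : ℝ} (hs : s ∈ Icc (0 : ℝ) (1 / 2)) :
    radicalFactor s ^ 2 * (1 - s) = 3 + s := by
  have h := radicand_pos hs
  unfold radicalFactor
  rw [div_pow, Real.sq_sqrt h.le, div_mul_eq_mul_div, div_eq_iff h.ne']
  ring

lemma radicalFactor_le {s C : ℝ} (hs : s ∈ Icc (0 : ℝ) (1 / 2)) (hC : 0 ≤ C)
    (h : 3 + s ≤ C ^ 2 * (1 - s)) : radicalFactor s ≤ C := by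
  have h1 : 0 < 1 - s := by linarith [hs.2]
  rw [← radicalFactor_sq hs] at h
  exact le_of_sq_le_sq (le_of_mul_le_mul_right h h1) hC

lemma radicalFactor_ge {s : ℝ} (hs : s ∈ Icc (0 : ℝ) (1 / 2)) : 1.7 ≤ radicalFactor s := by
  nlinarith [radicalFactor_sq hs, radicalFactor_pos hs, hs.1, hs.2]

lemma radicalFactor_le_of_mem {s : ℝ} (hs : s ∈ Icc (0 : ℝ) (1 / 2)) : radicalFactor s ≤ 2.7 :=
  radicalFactor_le hs (by norm_num) (by nlinarith [hs.2])

lemma radicalFactor_sub {s t : ℝ} (hs : s ∈ Icc (0 : ℝ) (1 / 2)) (ht : t ∈ Icc (0 : ℝ) (1 / 2))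
    (hst : s < t) :
    0 ≤ radicalFactor t - radicalFactor s ∧
      radicalFactor t - radicalFactor s ≤ 5 * (t - s) := by
  have h1s : (1 : ℝ) / 2 ≤ 1 - s := by linarith [hs.2]
  have h1t : (1 : ℝ) / 2 ≤ 1 - t := by linarith [ht.2]
  have hs2 := radicalFactor_sq hs
  have ht2 := radicalFactor_sq ht
  have hs3 := radicalFactor_ge hs
  have ht3 := radicalFactor_ge ht
  set u := radicalFactor s
  set v := radicalFactor t
  have key : (v - u) * ((v + u) * ((1 - s) * (1 - t))) = 4 * (t - s) := by
    linear_combination (1 - s) * ht2 - (1 - t) * hs2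
  have hprod : (1 : ℝ) / 4 ≤ (1 - s) * (1 - t) := by nlinarith
  have hbig : 0.85 ≤ (v + u) * ((1 - s) * (1 - t)) := by nlinarith
  have h0 : 0 ≤ v - u := by
    by_contra! h
    nlinarith
  exact ⟨h0, by nlinarith⟩

/-- Differences of the coefficients at ordered points of `[0, 1/2]`. -/
lemma coeff_sub_bounds {s t : ℝ} (hs : s ∈ Icc (0 : ℝ) (1 / 2)) (ht : t ∈ Icc (0 : ℝ) (1 / 2))
    (hst : s < t) :
    0 ≤ bEp t - bEp s ∧ -(230 * (t - s)) ≤ cEp t - cEp s ∧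
      -(20 * (t - s)) ≤ bEm t - bEm s ∧ -(100 * (t - s)) ≤ cEm t - cEm s := by
  obtain ⟨h0, h1⟩ := radicalFactor_sub hs ht hst
  have hs3 := radicalFactor_ge hs
  have ht3 := radicalFactor_le_of_mem ht
  have hs0 := hs.1
  have ht0 := ht.2
  have ht1 := ht.1
  rw [bEp_eq, bEp_eq, cEp_eq, cEp_eq, bEm_eq, bEm_eq, cEm_eq, cEm_eq]
  simp only [U00, U10]
  set u := radicalFactor s
  set v := radicalFactor t
  have hd : 0 < t - s := by linarith
  have hq : 0 ≤ t * (1 + t) - s * (1 + s) := by nlinarith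
  have hA : 0 ≤ v * t ^ 2 - u * s ^ 2 := by
    have : v * t ^ 2 - u * s ^ 2 = (v - u) * t ^ 2 + u * ((t + s) * (t - s)) := by ring
    rw [this]
    have : 0 ≤ t + s := by linarith
    have : 0 ≤ u := by linarith
    positivity
  have hA' : v * t ^ 2 - u * s ^ 2 ≤ 5 * (t - s) := by
    have h2 : (v - u) * t ^ 2 ≤ 5 * (t - s) * (1 / 4) := by
      apply mul_le_mul h1 (by nlinarith) (by positivity) (by linarith)
    have h3 : (t + s) * u ≤ 1 * 2.7 := by
      apply mul_le_mul (by linarith) (by linarith) (by linarith) (by norm_num)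
    nlinarith [mul_le_mul_of_nonneg_right h3 hd.le]
  have hB : v * (12 - 8 * t) - u * (12 - 8 * s) ≤ 60 * (t - s) := by
    have h2 : (v - u) * (12 - 8 * t) ≤ 5 * (t - s) * 12 := by
      apply mul_le_mul h1 (by linarith) (by linarith) (by linarith)
    nlinarith [mul_nonneg (by linarith : (0 : ℝ) ≤ u) hd.le]
  have hB' : -(22 * (t - s)) ≤ v * (12 - 8 * t) - u * (12 - 8 * s) := by
    have h2 : 0 ≤ (v - u) * (12 - 8 * t) := mul_nonneg h0 (by linarith)
    have h3 : u * (t - s) ≤ 2.7 * (t - s) := by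
      apply mul_le_mul_of_nonneg_right (by linarith) hd.le
    nlinarith
  refine ⟨by nlinarith, by nlinarith, by nlinarith, by nlinarith⟩

lemma continuousOn_radicalFactor : ContinuousOn radicalFactor (Icc (0 : ℝ) (1 / 2)) := by
  unfold radicalFactor
  refine ContinuousOn.div (by fun_prop) (by fun_prop) fun s hs => ?_
  exact (Real.sqrt_pos.2 (radicand_pos hs)).ne'

lemma continuousOn_Gp (y δ : ℝ) : ContinuousOn (fun s => Gp s y δ) (Icc (0 : ℝ) (1 / 2)) := by
  have h := continuousOn_radicalFactor
  simp only [Gp, bEp_eq, cEp_eq, aE]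
  fun_prop

lemma continuousOn_Gm (y δ : ℝ) : ContinuousOn (fun s => Gm s y δ) (Icc (0 : ℝ) (1 / 2)) := by
  have h := continuousOn_radicalFactor
  simp only [Gm, bEm_eq, cEm_eq, aE]
  fun_prop

lemma deltaMax_le : deltaMax ≤ 0.12 := by
  have h : Lmax ^ 10 = (muC * aMax) ^ 5 := by
    rw [Lmax, show (10 : ℕ) = 2 * 5 by norm_num, pow_mul, Real.sq_sqrt]
    norm_num [muC, aMax]
  rw [deltaMax, deltaFun, h]
  norm_num [rhoC, muC, aMax, aM]

lemma strictMonoOn_Gp {y δ : ℝ} (hδ : δ ∈ Ioc (0 : ℝ) 0.12) (hy : y ∈ Ioc (0 : ℝ) (1 / 2)) :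
    StrictMonoOn (fun s => Gp s y δ) (Icc (0 : ℝ) (1 / 2)) := by
  intro s hs t ht hst
  obtain ⟨h1, h2, -, -⟩ := coeff_sub_bounds hs ht hst
  have hy0 := hy.1
  have hd : 0 < t - s := by linarith
  have hy5 : y ^ 5 ≤ (1 / 2) ^ 5 := pow_le_pow_left₀ hy0.le hy.2 5
  have hq : 2 * δ * y ^ 5 ≤ 0.0075 := by
    nlinarith [mul_le_mul hδ.2 hy5 (by positivity) (by norm_num)]
  have hq0 : 0 ≤ 2 * δ * y ^ 5 := by have := hδ.1; positivity
  have hp0 : 0 ≤ 2 * δ * y ^ 3 := by have := hδ.1; positivity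
  have ha : 8 * (t - s) ≤ aE t - aE s := by
    unfold aE; nlinarith [hs.1, ht.1]
  have hb := mul_nonneg hp0 h1
  have hc := mul_le_mul_of_nonneg_left h2 hq0
  have hc' := mul_le_mul_of_nonneg_right hq hd.le
  simp only [Gp]
  nlinarith

lemma strictMonoOn_Gm {y δ : ℝ} (hδ : δ ∈ Ioc (0 : ℝ) 0.12) (hy : y ∈ Ioc (0 : ℝ) (1 / 2)) :
    StrictMonoOn (fun s => Gm s y δ) (Icc (0 : ℝ) (1 / 2)) := by
  intro s hs t ht hst
  obtain ⟨-, -, h1, h2⟩ := coeff_sub_bounds hs ht hst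
  have hy0 := hy.1
  have hd : 0 < t - s := by linarith
  have hy5 : y ^ 5 ≤ (1 / 2) ^ 5 := pow_le_pow_left₀ hy0.le hy.2 5
  have hy3 : y ^ 3 ≤ (1 / 2) ^ 3 := pow_le_pow_left₀ hy0.le hy.2 3
  have hq : 2 * δ * y ^ 5 ≤ 0.0075 := by
    nlinarith [mul_le_mul hδ.2 hy5 (by positivity) (by norm_num)]
  have hp : 2 * δ * y ^ 3 ≤ 0.03 := by
    nlinarith [mul_le_mul hδ.2 hy3 (by positivity) (by norm_num)]
  have hq0 : 0 ≤ 2 * δ * y ^ 5 := by have := hδ.1; positivity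
  have hp0 : 0 ≤ 2 * δ * y ^ 3 := by have := hδ.1; positivity
  have ha : 8 * (t - s) ≤ aE t - aE s := by
    unfold aE; nlinarith [hs.1, ht.1]
  have hb := mul_le_mul_of_nonneg_left h1 hp0
  have hb' := mul_le_mul_of_nonneg_right hp hd.le
  have hc := mul_le_mul_of_nonneg_left h2 hq0
  have hc' := mul_le_mul_of_nonneg_right hq hd.le
  simp only [Gm]
  nlinarith

lemma mC_bounds : 0.11651 < mC ∧ mC < 0.11652 := by
  have h1 : (4.58255 : ℝ) < Real.sqrt 21 := Real.lt_sqrt_of_sq_lt (by norm_num)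
  have h2 : Real.sqrt 21 < 4.5826 := (Real.sqrt_lt' (by norm_num)).2 (by norm_num)
  unfold mC
  constructor <;> linarith

lemma mC_mem : mC ∈ Icc (0 : ℝ) (1 / 2) := by
  obtain ⟨h1, h2⟩ := mC_bounds
  constructor <;> linarith

lemma aE_mC : aE mC = 0 := by
  have h : Real.sqrt 21 ^ 2 = 21 := Real.sq_sqrt (by norm_num)
  unfold aE mC
  linear_combination h / 5

lemma bEp_mC_pos : 0 < bEp mC := by
  have h := mC_bounds.1
  have hw := radicalFactor_pos mC_mem
  have hm : 0 < mC := by linarith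
  rw [bEp_eq, U00, U10]
  positivity

lemma cEp_neg {s : ℝ} (hs : s ∈ Icc (0 : ℝ) (1 / 2)) (h3 : s < 1 / 3) : cEp s < 0 := by
  have hw := radicalFactor_pos hs
  have h : 0 < radicalFactor s * (12 - 8 * s) := mul_pos hw (by linarith)
  rw [cEp_eq, U00, U10]
  linarith

lemma yHatMin_sq : yHatMin ^ 2 * cEp mC = -bEp mC := by
  have hb := bEp_mC_pos
  have hc := cEp_neg mC_mem (by linarith [mC_bounds.2])
  rw [yHatMin, Real.sq_sqrt (div_nonneg_of_nonpos (by linarith) hc.le),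
    div_mul_cancel₀ _ hc.ne]

lemma Gp_mC (y δ : ℝ) : Gp mC y δ = 2 * δ * y ^ 3 * cEp mC * (y ^ 2 - yHatMin ^ 2) := by
  rw [Gp, aE_mC]
  linear_combination 2 * δ * y ^ 3 * yHatMin_sq

lemma Gp_zero_neg {y δ : ℝ} (hδ : 0 < δ) (hy : 0 < y) : Gp 0 y δ < 0 := by
  have hc : cEp 0 < 0 := cEp_neg (by norm_num) (by norm_num)
  have hb : bEp 0 = 0 := by simp [bEp]
  have ha : aE 0 = -1 := by simp [aE]
  have : 2 * δ * y ^ 5 * cEp 0 < 0 := mul_neg_of_pos_of_neg (by positivity) hc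
  rw [Gp, ha, hb]
  linarith

lemma Gp_three_halves_mC_pos {y δ : ℝ} (hδ : δ ∈ Ioc (0 : ℝ) 0.12)
    (hy : y ∈ Ioc (0 : ℝ) (1 / 2)) : 0 < Gp (3 * mC / 2) y δ := by
  obtain ⟨hm1, hm2⟩ := mC_bounds
  set s := 3 * mC / 2 with hs
  have hs1 : 0.174765 < s := by linarith
  have hs2 : s < 0.17478 := by linarith
  have hmem : s ∈ Icc (0 : ℝ) (1 / 2) := ⟨by linarith, by linarith⟩
  have hw2 : radicalFactor s ≤ 1.9617 := radicalFactor_le hmem (by norm_num) (by linarith)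
  have hw1 := radicalFactor_ge hmem
  have ha : 0.55 ≤ aE s := by unfold aE; nlinarith
  have hb1 : 1.7 ≤ bEp s := by
    rw [bEp_eq, U00, U10]
    nlinarith [mul_le_mul hw1 (by nlinarith : (0.03 : ℝ) ≤ s ^ 2) (by norm_num) (by linarith)]
  have hc1 : -79 ≤ cEp s := by
    rw [cEp_eq, U00, U10]
    have := mul_le_mul hw2 (by linarith : 12 - 8 * s ≤ 10.602) (by linarith) (by norm_num)
    linarith
  have hy0 := hy.1
  have hmin : -(9025 / 4000) ≤ 1.7 * y ^ 3 - 79 * y ^ 5 := by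
    have hfac : 1.7 * y ^ 3 - 79 * y ^ 5 + 9025 / 4000 =
        (1 / 2 - y) * (79 * y ^ 4 + (79 / 4 - 1.7) * (2 * y ^ 3 + y ^ 2 + y / 2 + 1 / 4)
          + 3.4 * y ^ 3) := by ring
    have := mul_nonneg (by linarith [hy.2] : (0 : ℝ) ≤ 1 / 2 - y)
      (by positivity : 0 ≤ 79 * y ^ 4 + (79 / 4 - 1.7) * (2 * y ^ 3 + y ^ 2 + y / 2 + 1 / 4)
          + 3.4 * y ^ 3)
    linarith
  have hval : -(9025 / 4000) ≤ bEp s * y ^ 3 + cEp s * y ^ 5 := by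
    have h3 := mul_le_mul_of_nonneg_right hb1 (by positivity : 0 ≤ y ^ 3)
    have h5 := mul_le_mul_of_nonneg_right hc1 (by positivity : 0 ≤ y ^ 5)
    linarith
  unfold Gp
  nlinarith [mul_le_mul_of_nonneg_left hval hδ.1.le, hδ.2]

lemma Gm_mC_pos {y δ : ℝ} (hδ : 0 < δ) (hy : 0 < y) : 0 < Gm mC y δ := by
  obtain ⟨hm1, hm2⟩ := mC_bounds
  have hw2 := radicalFactor_le_of_mem mC_mem
  have hw1 := radicalFactor_ge mC_mem
  have hb : 0 < bEm mC := by
    rw [bEm_eq, U00, U10]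
    nlinarith [mul_le_mul hw2 (by nlinarith : mC ^ 2 ≤ 0.014) (by positivity) (by norm_num)]
  have hc : 0 < cEm mC := by
    rw [cEm_eq, U00, U10]
    nlinarith [mul_le_mul hw1 (by linarith : 11 ≤ 12 - 8 * mC) (by norm_num) (by linarith)]
  rw [Gm, aE_mC]
  positivity

lemma Gm_two_fifths_mC_neg {y δ : ℝ} (hδ : δ ∈ Ioc (0 : ℝ) 0.12)
    (hy : y ∈ Ioc (0 : ℝ) (1 / 2)) : Gm (2 * mC / 5) y δ < 0 := by
  obtain ⟨hm1, hm2⟩ := mC_bounds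
  set s := 2 * mC / 5 with hs
  have hs1 : 0.0466 < s := by linarith
  have hs2 : s < 0.04661 := by linarith
  have hmem : s ∈ Icc (0 : ℝ) (1 / 2) := ⟨by linarith, by linarith⟩
  have hw2 : radicalFactor s ≤ 1.788 := radicalFactor_le hmem (by norm_num) (by linarith)
  have hw1 := radicalFactor_pos hmem
  have ha : aE s ≤ -0.61 := by unfold aE; nlinarith
  have hb : bEm s ≤ 0.4 := by
    rw [bEm_eq, U00, U10]
    nlinarith [mul_nonneg hw1.le (sq_nonneg s)]
  have hc : cEm s ≤ 72 := by
    rw [cEm_eq, U00, U10]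
    have := mul_le_mul hw2 (by linarith : 12 - 8 * s ≤ 11.63) (by linarith) (by norm_num)
    linarith
  have hy0 := hy.1
  have hy5 : y ^ 5 ≤ (1 / 2) ^ 5 := pow_le_pow_left₀ hy0.le hy.2 5
  have hy3 : y ^ 3 ≤ (1 / 2) ^ 3 := pow_le_pow_left₀ hy0.le hy.2 3
  have hval : bEm s * y ^ 3 + cEm s * y ^ 5 ≤ 2.3 := by
    have h3 := mul_le_mul_of_nonneg_right hb (by positivity : 0 ≤ y ^ 3)
    have h5 := mul_le_mul_of_nonneg_right hc (by positivity : 0 ≤ y ^ 5)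
    linarith
  unfold Gm
  nlinarith [mul_le_mul_of_nonneg_left hval hδ.1.le, hδ.2]

/-- A continuous strictly increasing function on `[a, b]` changing sign between `l` and `r` has a
unique zero in `[a, b]`, and it lies in `(l, r)`. -/
lemma exists_unique_zero_of_strictMonoOn {F : ℝ → ℝ} {a b l r : ℝ}
    (hc : ContinuousOn F (Icc a b)) (hm : StrictMonoOn F (Icc a b))
    (hl : l ∈ Icc a b) (hr : r ∈ Icc a b) (hFl : F l < 0) (hFr : 0 < F r) :
    ∃ x, (x ∈ Icc a b ∧ F x = 0) ∧ (∀ x' ∈ Icc a b, F x' = 0 → x' = x) ∧ x ∈ Ioo l r := by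
  have hlr : l < r := (hm.lt_iff_lt hl hr).1 (hFl.trans hFr)
  have hsub : Icc l r ⊆ Icc a b := Icc_subset_Icc hl.1 hr.2
  obtain ⟨x, hx, hFx⟩ := intermediate_value_Ioo hlr.le (hc.mono hsub) ⟨hFl, hFr⟩
  have hxm : x ∈ Icc a b := hsub (Ioo_subset_Icc_self hx)
  exact ⟨x, ⟨hxm, hFx⟩, fun x' hx' h => hm.injOn hx' hxm (h.trans hFx.symm), hx⟩

/-- `G₊(m,ŷ_min;δ) = 0` for all `δ`; for each `δ ∈ (0,δ_max]` and `ŷ ∈ (0,1/2]`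
there are unique zeros `s₊(ŷ;δ)` and `s₋(ŷ;δ)` of `G₊(·,ŷ;δ)` and `G₋(·,ŷ;δ)` in `[0,1/2]`,
with the stated localizations. -/
theorem stmt5 :
    (∀ δ : ℝ, Gp mC yHatMin δ = 0) ∧
    ∀ δ ∈ Set.Ioc (0:ℝ) deltaMax, ∀ yh ∈ Set.Ioc (0:ℝ) (1/2),
      (∃ sp, (sp ∈ Set.Icc (0:ℝ) (1/2) ∧ Gp sp yh δ = 0) ∧
        (∀ s' ∈ Set.Icc (0:ℝ) (1/2), Gp s' yh δ = 0 → s' = sp) ∧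
        sp ∈ Set.Ioo 0 (3 * mC / 2) ∧
        (yHatMin < yh → sp ∈ Set.Ioo mC (3 * mC / 2)) ∧
        (yh < yHatMin → sp ∈ Set.Ioo 0 mC)) ∧
      (∃ sm, (sm ∈ Set.Icc (0:ℝ) (1/2) ∧ Gm sm yh δ = 0) ∧
        (∀ s' ∈ Set.Icc (0:ℝ) (1/2), Gm s' yh δ = 0 → s' = sm) ∧
        sm ∈ Set.Ioo (2 * mC / 5) mC) := by
  have hM0 : 0 ≤ yHatMin := Real.sqrt_nonneg _
  have hmC := mC_bounds
  refine ⟨fun δ => by rw [Gp_mC]; ring, fun δ hδ yh hy => ⟨?_, ?_⟩⟩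
  · have hδ' : δ ∈ Ioc (0 : ℝ) 0.12 := ⟨hδ.1, hδ.2.trans deltaMax_le⟩
    have hmono := strictMonoOn_Gp hδ' hy
    obtain ⟨sp, ⟨hsp, hzero⟩, huniq, hloc⟩ :=
      exists_unique_zero_of_strictMonoOn (continuousOn_Gp yh δ) hmono
        (l := 0) (r := 3 * mC / 2) (by norm_num) ⟨by linarith, by linarith⟩
        (Gp_zero_neg hδ.1 hy.1) (Gp_three_halves_mC_pos hδ' hy)
    have hcoef : 2 * δ * yh ^ 3 * cEp mC < 0 :=
      mul_neg_of_pos_of_neg (by have := hδ.1; have := hy.1; positivity)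
        (cEp_neg mC_mem (by linarith))
    refine ⟨sp, ⟨hsp, hzero⟩, huniq, hloc, fun h => ⟨?_, hloc.2⟩, fun h => ⟨hloc.1, ?_⟩⟩
    · refine (hmono.lt_iff_lt mC_mem hsp).1 ?_
      simp only [hzero, Gp_mC]
      exact mul_neg_of_neg_of_pos hcoef (by nlinarith)
    · refine (hmono.lt_iff_lt hsp mC_mem).1 ?_
      simp only [hzero, Gp_mC]
      exact mul_pos_of_neg_of_neg hcoef (by nlinarith [hy.1])
  · have hδ' : δ ∈ Ioc (0 : ℝ) 0.12 := ⟨hδ.1, hδ.2.trans deltaMax_le⟩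
    exact exists_unique_zero_of_strictMonoOn (continuousOn_Gm yh δ) (strictMonoOn_Gm hδ' hy)
      ⟨by linarith, by linarith⟩ mC_mem (Gm_two_fifths_mC_neg hδ' hy) (Gm_mC_pos hδ.1 hy.1)

end Secular
end
end

section
/- For k ∈ {1, 2}, the equation |1 − 16σ − 20σ²| = 2k·(1+2σ) has a unique solution Γ̂₀^(k) in the open interval (0, 1/2) (numerically Γ̂₀^(1) = 0.189897948556636…, Γ̂₀^(2) = 0.338516480713450…), while for every integer k ≥ 3 it has no solution in (0, 1/2). Define H_k(σ;δ) = 𝐚(σ)²·(1 + δ·U00) + δ²·𝐜₊(σ)·𝐜₋(σ) − 4k²·(1+2σ)²·(1 + δ·U00/2)². Then there exist δ₀ > 0 and M > 0 such that for every δ ∈ [0, δ₀] and each k ∈ {1, 2} there exists Γ̂^(k)(δ) ∈ (0, 1/2) with H_k(Γ̂^(k)(δ); δ) = 0 and |Γ̂^(k)(δ) − Γ̂₀^(k)| ≤ M·δ². -/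
noncomputable section
open Real Set

namespace Secular

/-- `H_k(σ;δ)` whose zeros characterize first-order monodromy eigenvalue `(−1)^k`. -/
def Hk (k : ℕ) (σ δ : ℝ) : ℝ :=
  (aA σ) ^ 2 * (1 + δ * U00) + δ ^ 2 * cPl σ * cMi σ
    - 4 * (k : ℝ) ^ 2 * (1 + 2*σ) ^ 2 * (1 + δ * U00 / 2) ^ 2

theorem abs_aA_eq_iff {K σ : ℝ} (hK : 1 ≤ K) (hσ : 0 < σ) :
    |aA σ| = 2 * K * (1 + 2 * σ) ↔ 20 * σ ^ 2 + (16 - 4 * K) * σ - (1 + 2 * K) = 0 := by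
  have hKσ : 0 < K * σ := by positivity
  rw [abs_eq (by positivity), aA]
  constructor
  · rintro (h | h)
    · nlinarith
    · linarith
  · intro h
    right
    linarith

theorem existsUnique_abs_aA_eq {K : ℝ} (hK : 1 ≤ K) (hK3 : K < 3) :
    ∃! σ : ℝ, σ ∈ Ioo (0:ℝ) (1/2) ∧ |aA σ| = 2 * K * (1 + 2 * σ) := by
  have hD : (0:ℝ) ≤ K ^ 2 + 2 * K + 21 := by positivity
  have hlo : 4 - K < √(K ^ 2 + 2 * K + 21) := Real.lt_sqrt_of_sq_lt (by nlinarith)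
  have hhi : √(K ^ 2 + 2 * K + 21) < 9 - K :=
    (Real.sqrt_lt' (by linarith)).2 (by nlinarith)
  have hpos : 0 < (K - 4 + √(K ^ 2 + 2 * K + 21)) / 10 := by linarith
  refine ⟨(K - 4 + √(K ^ 2 + 2 * K + 21)) / 10, ⟨⟨hpos, by linarith⟩, ?_⟩, ?_⟩
  · rw [abs_aA_eq_iff hK hpos]
    linear_combination (1 / 5) * Real.sq_sqrt hD
  · rintro τ ⟨⟨hτ, -⟩, h⟩
    rw [abs_aA_eq_iff hK hτ] at h
    have hsq : √(K ^ 2 + 2 * K + 21) = √((10 * τ + (4 - K)) ^ 2) := by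
      congr 1
      linear_combination (-5) * h
    have hnn : 0 ≤ 10 * τ + (4 - K) := by linarith
    rw [hsq, Real.sqrt_sq hnn]
    ring

theorem abs_aA_ne {K σ : ℝ} (hK : 3 ≤ K) (hσ : σ ∈ Ioo (0:ℝ) (1/2)) :
    |aA σ| ≠ 2 * K * (1 + 2 * σ) := by
  rw [Ne, abs_aA_eq_iff (by linarith) hσ.1]
  obtain ⟨h0, h1⟩ := hσ
  nlinarith [mul_nonneg (sub_nonneg.2 hK) h0.le, mul_pos h0 (sub_pos.2 h1)]

theorem bB_sq {σ : ℝ} (hσ : σ ∈ Ioo (0:ℝ) (1/2)) :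
    bB σ ^ 2 = (2 * σ + 3) ^ 2 * (3 - 4 * σ - 4 * σ ^ 2) := by
  obtain ⟨h0, h1⟩ := hσ
  rw [bB, mul_pow, Real.sq_sqrt (by nlinarith)]

theorem bB_sq_le {σ : ℝ} (hσ : σ ∈ Ioo (0:ℝ) (1/2)) : bB σ ^ 2 ≤ 48 := by
  rw [bB_sq hσ]
  obtain ⟨h0, h1⟩ := hσ
  have h2 : (2 * σ + 3) ^ 2 ≤ 16 := by nlinarith
  have h3 : 3 - 4 * σ - 4 * σ ^ 2 ≤ 3 := by nlinarith
  nlinarith [sq_nonneg (2 * σ + 3)]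

theorem Hk_eq (k : ℕ) (σ δ : ℝ) :
    Hk k σ δ = (20 * σ ^ 2 + (16 - 4 * k) * σ - (1 + 2 * k)) *
        (20 * σ ^ 2 + (16 + 4 * k) * σ - (1 - 2 * k)) * (1 + δ * U00 / 2) ^ 2
      - δ ^ 2 * (25 * U10 ^ 2 / 9) * bB σ ^ 2 := by
  simp only [Hk, cPl, cMi, aA]
  ring

theorem continuous_Hk (k : ℕ) (δ : ℝ) : Continuous fun σ => Hk k σ δ := by
  unfold Hk cPl cMi aA bB
  fun_prop

theorem exists_Hk_eq_zero {k : ℕ} (hk1 : 1 ≤ k) (hk2 : k ≤ 2) {δ σ₀ : ℝ}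
    (hδ : δ ∈ Icc (0:ℝ) (1/10)) (hσ₀ : σ₀ ∈ Ioo (0:ℝ) (1/2))
    (h : |aA σ₀| = 2 * (k : ℝ) * (1 + 2 * σ₀)) :
    ∃ σ ∈ Ioo (0:ℝ) (1/2), Hk k σ δ = 0 ∧ |σ - σ₀| ≤ 10 * δ ^ 2 := by
  have hK1 : (1:ℝ) ≤ k := by exact_mod_cast hk1
  have hK2 : (k:ℝ) ≤ 2 := by exact_mod_cast hk2
  obtain ⟨hδ0, hδ1⟩ := hδ
  obtain ⟨h0, -⟩ := hσ₀
  rw [abs_aA_eq_iff hK1 h0] at h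
  have hlt : σ₀ < 2 / 5 := by nlinarith
  have hδ2 : 10 * δ ^ 2 ≤ 1 / 10 := by nlinarith
  have hδnn : 0 ≤ 10 * δ ^ 2 := by positivity
  have hleft : Hk k σ₀ δ ≤ 0 := by
    rw [Hk_eq, h]
    have : 0 ≤ δ ^ 2 * (25 * U10 ^ 2 / 9) * bB σ₀ ^ 2 := by positivity
    linarith
  have hright : 0 ≤ Hk k (σ₀ + 10 * δ ^ 2) δ := by
    set σ := σ₀ + 10 * δ ^ 2 with hσ
    have hσ0 : 0 < σ := by linarith
    have hp : 80 * δ ^ 2 ≤ 20 * σ ^ 2 + (16 - 4 * k) * σ - (1 + 2 * k) := by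
      have hfac : 20 * σ ^ 2 + (16 - 4 * k) * σ - (1 + 2 * k)
          = 10 * δ ^ 2 * (20 * (σ + σ₀) + 16 - 4 * k) := by
        rw [hσ]
        linear_combination h
      rw [hfac]
      nlinarith
    have hq : 1 ≤ 20 * σ ^ 2 + (16 + 4 * k) * σ - (1 - 2 * k) := by
      have : 0 ≤ (16 + 4 * (k : ℝ)) * σ := by positivity
      nlinarith [sq_nonneg σ]
    have hr : 1 ≤ (1 + δ * U00 / 2) ^ 2 := by
      have : 0 ≤ δ * U00 / 2 := by
        unfold U00
        positivity
      exact one_le_pow₀ (by linarith)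
    have hU : 25 * U10 ^ 2 / 9 ≤ 1 := by
      norm_num [U10]
    have hb : bB σ ^ 2 ≤ 48 := bB_sq_le ⟨hσ0, by linarith⟩
    have hUb : 25 * U10 ^ 2 / 9 * bB σ ^ 2 ≤ 1 * 48 := by gcongr
    have hlow : 80 * δ ^ 2 * 1 * 1 ≤ (20 * σ ^ 2 + (16 - 4 * k) * σ - (1 + 2 * k)) *
        (20 * σ ^ 2 + (16 + 4 * k) * σ - (1 - 2 * k)) * (1 + δ * U00 / 2) ^ 2 := by
      have hp0 := (by positivity : (0:ℝ) ≤ 80 * δ ^ 2).trans hp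
      gcongr
    rw [Hk_eq]
    nlinarith [mul_le_mul_of_nonneg_left hUb (sq_nonneg δ), sq_nonneg δ]
  obtain ⟨σ, ⟨hσl, hσr⟩, hσH⟩ := intermediate_value_Icc (by linarith : σ₀ ≤ σ₀ + 10 * δ ^ 2)
    (continuous_Hk k δ).continuousOn ⟨hleft, hright⟩
  refine ⟨σ, ⟨by linarith, by linarith⟩, hσH, ?_⟩
  rw [abs_of_nonneg (by linarith)]
  linarith

/-- for `k = 1,2` the equation `|1−16σ−20σ²| = 2k(1+2σ)` has a unique solution
`Γ̂₀^(k) ∈ (0,1/2)`, for `k ≥ 3` none; and the zeros of `H_k(·;δ)` are `δ²`-close to `Γ̂₀^(k)`,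
uniformly for small `δ`. -/
theorem stmt16 :
    (∀ k : ℕ, k = 1 ∨ k = 2 →
      ∃! σ : ℝ, σ ∈ Set.Ioo (0:ℝ) (1/2) ∧ |aA σ| = 2 * (k : ℝ) * (1 + 2*σ)) ∧
    (∀ k : ℕ, 3 ≤ k →
      ∀ σ ∈ Set.Ioo (0:ℝ) (1/2), |aA σ| ≠ 2 * (k : ℝ) * (1 + 2*σ)) ∧
    (∃ δ0 > (0:ℝ), ∃ M > (0:ℝ),
      ∀ δ ∈ Set.Icc (0:ℝ) δ0, ∀ k : ℕ, k = 1 ∨ k = 2 →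
        ∀ σ0 : ℝ, σ0 ∈ Set.Ioo (0:ℝ) (1/2) → |aA σ0| = 2 * (k : ℝ) * (1 + 2*σ0) →
          ∃ σk ∈ Set.Ioo (0:ℝ) (1/2), Hk k σk δ = 0 ∧ |σk - σ0| ≤ M * δ ^ 2) := by
  refine ⟨?_, fun k hk σ hσ => abs_aA_ne (by exact_mod_cast hk) hσ, 1 / 10, by norm_num, 10,
    by norm_num, fun δ hδ k hk σ₀ hσ₀ h =>
      exists_Hk_eq_zero (by omega) (by omega) hδ hσ₀ h⟩
  rintro k (rfl | rfl) <;> exact existsUnique_abs_aA_eq (by norm_num) (by norm_num)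

end Secular
end
end
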